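/- arXiv:1911.01336 — 4 statements merged into one kernel-verified Lean document; each statement's English description precedes it below -/
import Mathlib

section
/- Every nonprincipal ultrafilter on ℕ is a Rosenthal family: if u is a nonprincipal ultrafilter on ℕ, then for every Rosenthal matrix M and every ε > 0 there is a set A ∈ u such that M is ε-fragmented by A. -/
/-- A *Rosenthal matrix* is a matrix `M = (m_{k,n})` of non-negative reals whose rows are
summable and such that `‖M‖_∞ = sup_k Σ_n m_{k,n}` is finite. -/
def IsRosenthalMatrix (M : ℕ → ℕ → ℝ) : Prop :=
  (∀ k n, 0 ≤ M k n) ∧ (∀ k, Summable (M k)) ∧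
    BddAbove (Set.range fun k => ∑' n, M k n)

/-- `M` is `ε`-fragmented by `A`: for every `k ∈ A`, `Σ_{n ∈ A \ {k}} m_{k,n} ≤ ε`. -/
def Fragments (M : ℕ → ℕ → ℝ) (ε : ℝ) (A : Set ℕ) : Prop :=
  ∀ k ∈ A, ∑' n : (A \ {k} : Set ℕ), M k ↑n ≤ ε


open Finset Filter in
/-- A nonnegative square matrix with row sums at most `C` has a positive weight vector `u` with
`u A ≤ 2 C u`. -/
theorem exists_pos_weight_vecMul_le {ι : Type*} [Fintype ι] (A : ι → ι → ℝ) (C : ℝ) (hC : 0 < C)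
    (hA : ∀ i j, 0 ≤ A i j) (hrow : ∀ i, ∑ j, A i j ≤ C) :
    ∃ u : ι → ℝ, (∀ i, 0 < u i) ∧ ∀ j, ∑ i, u i * A i j ≤ 2 * C * u j := by
  let w : ℕ → ι → ℝ := fun k =>
    Nat.rec (fun _ => 1) (fun _ v j => (∑ i, v i * A i j) / (2 * C)) k
  have w_zero (j) : w 0 j = 1 := rfl
  have w_succ (k j) : w (k + 1) j = (∑ i, w k i * A i j) / (2 * C) := rfl
  have w_nonneg (k j) : 0 ≤ w k j := by
    induction k generalizing j with
    | zero => simp [w_zero]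
    | succ k ih =>
      rw [w_succ]
      exact div_nonneg (sum_nonneg fun i _ => mul_nonneg (ih i) (hA i j)) (by positivity)
  have w_sum (k) : ∑ j, w k j ≤ Fintype.card ι * (1 / 2 : ℝ) ^ k := by
    induction k with
    | zero => simp [w_zero]
    | succ k ih =>
      have h : ∑ j, ∑ i, w k i * A i j ≤ (∑ i, w k i) * C := by
        rw [sum_comm, sum_mul]
        refine sum_le_sum fun i _ => ?_
        rw [← mul_sum]
        exact mul_le_mul_of_nonneg_left (hrow i) (w_nonneg k i)
      simp only [w_succ]
      rw [← sum_div, div_le_iff₀ (by positivity), pow_succ]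
      nlinarith
  have w_summable (j) : Summable fun k => w k j :=
    Summable.of_nonneg_of_le (fun k => w_nonneg k j)
      (fun k => (single_le_sum (fun i _ => w_nonneg k i) (mem_univ j)).trans (w_sum k))
      (summable_geometric_two.mul_left _)
  have tsum_split (j) : ∑' k, w k j = 1 + ∑' k, w (k + 1) j := by
    rw [(w_summable j).tsum_eq_zero_add, w_zero]
  refine ⟨fun j => ∑' k, w k j, fun j => ?_, fun j => ?_⟩
  · have h : 0 ≤ ∑' k, w (k + 1) j := tsum_nonneg fun k => w_nonneg (k + 1) j
    linarith [tsum_split j]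
  · have h : ∑' k, w (k + 1) j = (∑ i, (∑' k, w k i) * A i j) / (2 * C) := by
      simp only [w_succ]
      rw [tsum_div_const, Summable.tsum_finsetSum fun i _ => (w_summable i).mul_right _]
      simp only [tsum_mul_right]
    have h' : (∑ i, (∑' k, w k i) * A i j) / (2 * C) ≤ ∑' k, w k j := by
      linarith [tsum_split j]
    rw [div_le_iff₀ (by positivity)] at h'
    linarith

open Finset in
/-- Every symmetric matrix with zero diagonal admits a colouring in which the weight from any
vertex to its own colour class is at most its weight to any other colour class. -/
theorem exists_coloring_sum_own_class_le {ι κ : Type*} [Fintype ι] [DecidableEq ι] [Fintype κ]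
    [DecidableEq κ] [Nonempty κ] (B : ι → ι → ℝ) (hsymm : ∀ i j, B i j = B j i)
    (hdiag : ∀ i, B i i = 0) :
    ∃ c : ι → κ, ∀ k l, (∑ j, if c j = c k then B k j else 0) ≤
      ∑ j, if c j = l then B k j else 0 := by
  let E : (ι → κ) → ℝ := fun c => ∑ i, ∑ j, if c j = c i then B i j else 0
  obtain ⟨c, hc⟩ := Finite.exists_min E
  refine ⟨c, fun k l => ?_⟩
  have split (d : ι → κ) : E d = 2 * (∑ j ∈ univ.erase k, if d j = d k then B k j else 0) +
      ∑ i ∈ univ.erase k, ∑ j ∈ univ.erase k, if d j = d i then B i j else 0 := by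
    have inner (i) : (∑ j, if d j = d i then B i j else 0) = (if d k = d i then B i k else 0) +
        ∑ j ∈ univ.erase k, if d j = d i then B i j else 0 :=
      (add_sum_erase univ _ (mem_univ k)).symm
    have swap : (∑ i ∈ univ.erase k, if d k = d i then B i k else 0) =
        ∑ j ∈ univ.erase k, if d j = d k then B k j else 0 :=
      sum_congr rfl fun i _ => by simp only [eq_comm (a := d k), hsymm i k]
    simp only [E]
    rw [← add_sum_erase univ _ (mem_univ k)]
    simp only [inner]
    rw [sum_add_distrib, swap, hdiag]
    simp
    ring
  have full (m : κ) : (∑ j, if c j = m then B k j else 0) =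
      ∑ j ∈ univ.erase k, if c j = m then B k j else 0 := by
    rw [← add_sum_erase univ _ (mem_univ k)]
    simp [hdiag]
  have off (j) (hj : j ∈ univ.erase k) : Function.update c k l j = c j :=
    Function.update_of_ne (ne_of_mem_erase hj) _ _
  have own : (∑ j ∈ univ.erase k, if Function.update c k l j = Function.update c k l k
      then B k j else 0) = ∑ j ∈ univ.erase k, if c j = l then B k j else 0 :=
    sum_congr rfl fun j hj => by rw [off j hj, Function.update_self]
  have rest : (∑ i ∈ univ.erase k, ∑ j ∈ univ.erase k,
      if Function.update c k l j = Function.update c k l i then B i j else 0) =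
      ∑ i ∈ univ.erase k, ∑ j ∈ univ.erase k, if c j = c i then B i j else 0 :=
    sum_congr rfl fun i hi => sum_congr rfl fun j hj => by rw [off j hj, off i hi]
  have h := hc (Function.update c k l)
  rw [split, split, own, rest] at h
  rw [full, full]
  linarith

open Finset in
/-- Finite paving: a nonnegative matrix with row sums at most `C` can be coloured with `κ` so that
each row has off-diagonal weight at most `3 C / |κ|` inside its own colour class. -/
theorem exists_coloring_sum_le {ι κ : Type*} [Fintype ι] [DecidableEq ι] [Fintype κ]
    [DecidableEq κ] [Nonempty κ] (A : ι → ι → ℝ) (C : ℝ) (hC : 0 < C)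
    (hA : ∀ i j, 0 ≤ A i j) (hrow : ∀ i, ∑ j, A i j ≤ C) :
    ∃ c : ι → κ, ∀ k, ∑ j with c j = c k ∧ j ≠ k, A k j ≤ 3 * C / Fintype.card κ := by
  obtain ⟨u, hu, huA⟩ := exists_pos_weight_vecMul_le A C hC hA hrow
  let B : ι → ι → ℝ := fun i j => if i = j then 0 else u i * A i j + u j * A j i
  have term_nonneg (i j) : 0 ≤ u i * A i j := mul_nonneg (hu i).le (hA i j)
  obtain ⟨c, hc⟩ := exists_coloring_sum_own_class_le (κ := κ) B
    (fun i j => by simp only [B, eq_comm (a := i), add_comm]) (fun i => by simp [B])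
  refine ⟨c, fun k => ?_⟩
  have total : ∑ j, B k j ≤ 3 * C * u k := by
    calc ∑ j, B k j ≤ ∑ j, (u k * A k j + u j * A j k) := by
          refine sum_le_sum fun j _ => ?_
          simp only [B]
          split_ifs
          · exact add_nonneg (term_nonneg _ _) (term_nonneg _ _)
          · exact le_rfl
      _ = u k * ∑ j, A k j + ∑ j, u j * A j k := by rw [sum_add_distrib, mul_sum]
      _ ≤ 3 * C * u k := by nlinarith [huA k, mul_le_mul_of_nonneg_left (hrow k) (hu k).le]
  have average : Fintype.card κ * (∑ j, if c j = c k then B k j else 0) ≤ ∑ j, B k j := by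
    calc Fintype.card κ * (∑ j, if c j = c k then B k j else 0)
        = ∑ _l : κ, ∑ j, if c j = c k then B k j else 0 := by simp
      _ ≤ ∑ l, ∑ j, if c j = l then B k j else 0 := sum_le_sum fun l _ => hc k l
      _ = ∑ j, B k j := by rw [sum_comm]; simp
  have lower : u k * ∑ j with c j = c k ∧ j ≠ k, A k j ≤ ∑ j, if c j = c k then B k j else 0 := by
    rw [mul_sum, sum_filter]
    refine sum_le_sum fun j _ => ?_
    by_cases hjk : j = k
    · simp [hjk, B]
    · by_cases hcj : c j = c k
      · simp [hjk, hcj, B, Ne.symm hjk, term_nonneg]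
      · simp [hcj]
  have card_pos : (0 : ℝ) < Fintype.card κ := by exact_mod_cast Fintype.card_pos
  rw [le_div_iff₀ card_pos]
  refine le_of_mul_le_mul_left ?_ (hu k)
  nlinarith [mul_le_mul_of_nonneg_left lower card_pos.le]

/-- A map to a finite type is constant on a set of a given ultrafilter. -/
theorem Ultrafilter.exists_eventually_eq_const {α κ : Type*} [Finite κ] (u : Ultrafilter α)
    (f : α → κ) : ∃ i, ∀ᶠ a in u, f a = i := by
  by_contra! h
  obtain ⟨a, ha⟩ := (Filter.eventually_all.2 h).exists
  exact ha _ rfl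

open Finset Filter in
/-- Infinite paving: a Rosenthal matrix admits a finite colouring of `ℕ` each of whose
colour classes `ε`-fragments it. -/
theorem IsRosenthalMatrix.exists_coloring_fragments {M : ℕ → ℕ → ℝ} (hM : IsRosenthalMatrix M)
    {ε : ℝ} (hε : 0 < ε) :
    ∃ (t : ℕ) (c : ℕ → Fin t), ∀ i, Fragments M ε (c ⁻¹' {i}) := by
  obtain ⟨hnonneg, hsum, C₀, hC₀⟩ := hM
  obtain ⟨C, hC, hrow⟩ : ∃ C : ℝ, 0 < C ∧ ∀ k, ∑' n, M k n ≤ C :=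
    ⟨max C₀ 1, by positivity, fun k => (hC₀ ⟨k, rfl⟩).trans (le_max_left _ _)⟩
  obtain ⟨t, ht⟩ := exists_nat_gt (3 * C / ε)
  have t_pos : (0 : ℝ) < t := lt_trans (by positivity) ht
  have : NeZero t := ⟨by rintro rfl; simp at t_pos⟩
  have hbound : 3 * C / t ≤ ε := by
    rw [div_lt_iff₀ hε] at ht
    rw [div_le_iff₀ t_pos]
    linarith
  have fin_coloring (N : ℕ) : ∃ c : ℕ → Fin t, ∀ k < N, ∀ s : Finset ℕ,
      (∀ n ∈ s, n < N ∧ c n = c k ∧ n ≠ k) → ∑ n ∈ s, M k n ≤ ε := by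
    obtain ⟨c, hc⟩ := exists_coloring_sum_le (ι := Fin N) (κ := Fin t) (fun i j => M i j) C hC
      (fun i j => hnonneg i j) fun i => by
        rw [Fin.sum_univ_eq_sum_range (fun j => M i j)]
        exact ((hsum i).sum_le_tsum _ fun n _ => hnonneg i n).trans (hrow i)
    refine ⟨fun n => if h : n < N then c ⟨n, h⟩ else 0, fun k hk s hs => ?_⟩
    have h := (hc ⟨k, hk⟩).trans (by simpa using hbound)
    refine le_trans ?_ h
    refine le_of_le_of_eq ?_ (sum_map _ Fin.valEmbedding fun n => M k n)
    refine sum_le_sum_of_subset_of_nonneg (fun n hn => ?_) fun n _ _ => hnonneg k n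
    obtain ⟨hnN, hcol, hne⟩ := hs n hn
    simp only [hnN, hk, dif_pos] at hcol
    simp only [Finset.mem_map, mem_filter, mem_univ, true_and]
    exact ⟨⟨n, hnN⟩, ⟨hcol, by simpa [Fin.ext_iff] using hne⟩, rfl⟩
  choose d hd using fin_coloring
  choose c hc using fun n => (hyperfilter ℕ).exists_eventually_eq_const fun N => d N n
  refine ⟨t, c, fun i k hk => ?_⟩
  have hlarge (n : ℕ) : ∀ᶠ N in (hyperfilter ℕ : Filter ℕ), n < N :=
    Nat.hyperfilter_le_atTop (eventually_gt_atTop n)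
  refine ((hsum k).subtype _).tsum_le_of_sum_le fun s => ?_
  have hall : ∀ᶠ N in (hyperfilter ℕ : Filter ℕ), ∀ n ∈ s, (n : ℕ) < N ∧ d N n = c n :=
    (eventually_all_finset s).2 fun n _ => (hlarge n).and (hc n)
  obtain ⟨N, hN, hkN, hck⟩ := (hall.and ((hlarge k).and (hc k))).exists
  have h := hd N k hkN (s.map (Function.Embedding.subtype _)) fun n hn => by
    obtain ⟨m, hm, rfl⟩ := Finset.mem_map.1 hn
    obtain ⟨hmN, hcm⟩ := hN m hm
    refine ⟨hmN, ?_, m.2.2⟩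
    have hmi : c m = i := m.2.1
    have hki : c k = i := hk
    simp [hcm, hck, hmi, hki]
  simpa [sum_map] using h

/-- Every nonprincipal ultrafilter on `ℕ` is a Rosenthal family: for every Rosenthal matrix
`M` and every `ε > 0` there is `A ∈ u` such that `M` is `ε`-fragmented by `A`. -/
theorem ultrafilter_is_rosenthal_family (u : Ultrafilter ℕ)
    (hu : (u : Filter ℕ) ≤ Filter.cofinite)
    (M : ℕ → ℕ → ℝ) (hM : IsRosenthalMatrix M) (ε : ℝ) (hε : 0 < ε) :
    ∃ A ∈ u, Fragments M ε A := by
  obtain ⟨t, c, hc⟩ := hM.exists_coloring_fragments hε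
  obtain ⟨i, hi⟩ := u.exists_eventually_eq_const c
  exact ⟨c ⁻¹' {i}, hi, hc i⟩
end

section
/- The Rosenthal number ros is less than or equal to the reaping number 𝔯. -/
/-- A *Rosenthal family*: a family of infinite subsets of `ℕ` such that every Rosenthal
matrix is `ε`-fragmented by some member of the family, for every `ε > 0`. -/
def IsRosenthalFamily (F : Set (Set ℕ)) : Prop :=
  (∀ A ∈ F, A.Infinite) ∧
    ∀ M : ℕ → ℕ → ℝ, IsRosenthalMatrix M → ∀ ε : ℝ, 0 < ε → ∃ A ∈ F, Fragments M ε A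

/-- The Rosenthal number `ros`: the minimal cardinality of a Rosenthal family. -/
noncomputable def rosenthalNumber : Cardinal :=
  sInf {c | ∃ F : Set (Set ℕ), IsRosenthalFamily F ∧ Cardinal.mk F = c}

/-- The reaping number `𝔯`: the minimal cardinality of a family `F` of infinite subsets of
`ℕ` such that no single `X ⊆ ℕ` splits all members of `F` (i.e. there is no `X` with both
`A ∩ X` and `A \ X` infinite for all `A ∈ F`). -/
noncomputable def reapingNumber : Cardinal :=
  sInf {c | ∃ F : Set (Set ℕ), (∀ A ∈ F, A.Infinite) ∧
    (¬ ∃ X : Set ℕ, ∀ A ∈ F, (A ∩ X).Infinite ∧ (A \ X).Infinite) ∧ Cardinal.mk F = c}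

/-- Greedy colouring: if all finite row sums are at most `K * δ`, then `K` colours suffice to make
the part of each row that lies above the diagonal and in the row's own colour at most `δ`. -/
lemma exists_coloring_sum_above_le {α : Type*} [LinearOrder α] (M : α → α → ℝ)
    (hM : ∀ k n, 0 ≤ M k n) {K : ℕ} (hK : 0 < K) {δ : ℝ}
    (hδ : ∀ k (s : Finset α), ∑ n ∈ s, M k n ≤ K * δ) (s : Finset α) :
    ∃ f : α → Fin K, ∀ k ∈ s, ∑ n ∈ s with k < n ∧ f n = f k, M k n ≤ δ := by
  have : NeZero K := ⟨hK.ne'⟩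
  induction s using Finset.induction_on_min with
  | empty => exact ⟨fun _ => 0, by simp⟩
  | insert a s ha ih =>
    obtain ⟨f, hf⟩ := ih
    obtain ⟨v, -, hv⟩ := Finset.exists_le_of_sum_le (s := (Finset.univ : Finset (Fin K)))
      (f := fun v => ∑ n ∈ s with f n = v, M a n) (g := fun _ => δ) Finset.univ_nonempty (by
        rw [Finset.sum_fiberwise]
        simpa using hδ a s)
    refine ⟨Function.update f a v, fun k hk => ?_⟩
    rcases Finset.mem_insert.1 hk with rfl | hks
    · refine (Finset.sum_le_sum_of_subset_of_nonneg ?_ fun n _ _ => hM k n).trans hv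
      intro n hn
      simp only [Finset.mem_filter, Finset.mem_insert, Function.update_self] at hn ⊢
      obtain ⟨h1, h2, h3⟩ := hn
      rw [Function.update_of_ne h2.ne'] at h3
      exact ⟨h1.resolve_left h2.ne', h3⟩
    · refine (Finset.sum_le_sum_of_subset_of_nonneg ?_ fun n _ _ => hM k n).trans (hf k hks)
      intro n hn
      simp only [Finset.mem_filter, Finset.mem_insert] at hn ⊢
      obtain ⟨h1, h2, h3⟩ := hn
      have hn' : n ≠ a := ((ha k hks).trans h2).ne'
      rw [Function.update_of_ne hn', Function.update_of_ne (ha k hks).ne'] at h3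
      exact ⟨h1.resolve_left hn', h2, h3⟩

/-- Compactness: a family of colourings by a finite set of colours has a limit that agrees with
cofinally many of them on each finite set. -/
lemma exists_limit_coloring {ι : Type*} [Finite ι] (f : ℕ → ℕ → ι) :
    ∃ c : ℕ → ι, ∀ L : ℕ, ∃ N ≥ L, ∀ n < L, f N n = c n := by
  have h : ∀ n, ∃ v, ∀ᶠ N in (Filter.hyperfilter ℕ : Filter ℕ), f N n = v := fun n => by
    have : ∀ᶠ N in (Filter.hyperfilter ℕ : Filter ℕ), ∃ v, f N n = v :=
      Filter.Eventually.of_forall fun N => ⟨_, rfl⟩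
    exact Ultrafilter.eventually_exists_iff.1 this
  choose c hc using h
  refine ⟨c, fun L => ?_⟩
  have h1 : ∀ᶠ N in (Filter.hyperfilter ℕ : Filter ℕ), ∀ n ∈ Set.Iio L, f N n = c n :=
    (Filter.eventually_all_finite (Set.finite_Iio L)).2 fun n _ => hc n
  have h2 : ∀ᶠ N in (Filter.hyperfilter ℕ : Filter ℕ), L ≤ N :=
    Nat.hyperfilter_le_atTop (Filter.eventually_ge_atTop L)
  obtain ⟨N, hN, hL⟩ := (h1.and h2).exists
  exact ⟨N, hL, hN⟩

/-- Paving lemma: `ℕ` can be coloured by finitely many colours so that every monochromatic set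
`ε`-fragments `M`. -/
lemma IsRosenthalMatrix.exists_paving {M : ℕ → ℕ → ℝ} (hM : IsRosenthalMatrix M) {ε : ℝ}
    (hε : 0 < ε) :
    ∃ (K : ℕ) (c : ℕ → Fin K × Fin K), ∀ A : Set ℕ, (∀ i ∈ A, ∀ j ∈ A, c i = c j) →
      Fragments M ε A := by
  classical
  obtain ⟨h0, hs, C, hC⟩ := hM
  obtain ⟨K, hK⟩ := exists_nat_gt (max 0 (C / (ε / 2)))
  have hKpos : 0 < K := by exact_mod_cast (le_max_left _ _).trans_lt hK
  have hCK : C ≤ K * (ε / 2) :=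
    ((div_lt_iff₀ (half_pos hε)).1 ((le_max_right _ _).trans_lt hK)).le
  have hδ : ∀ k (s : Finset ℕ), ∑ n ∈ s, M k n ≤ K * (ε / 2) := fun k s =>
    ((hs k).sum_le_tsum s fun n _ => h0 k n).trans ((hC ⟨k, rfl⟩).trans hCK)
  have hfin : ∀ N : ℕ, ∃ f : ℕ → Fin K × Fin K, ∀ k < N,
      ∑ n ∈ Finset.range N with n ≠ k ∧ f n = f k, M k n ≤ ε := fun N => by
    obtain ⟨f, hf⟩ := exists_coloring_sum_above_le M h0 hKpos hδ (Finset.range N)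
    obtain ⟨(g : ℕ → Fin K), hg⟩ := exists_coloring_sum_above_le (α := ℕᵒᵈ) M h0 hKpos hδ (Finset.range N)
    refine ⟨fun n => (f n, g n), fun k hk => ?_⟩
    have h1 := hf k (Finset.mem_range.2 hk)
    have h2 : ∑ n ∈ Finset.range N with n < k ∧ g n = g k, M k n ≤ ε / 2 :=
      hg k (Finset.mem_range.2 hk)
    refine (Finset.sum_le_sum_of_subset_of_nonneg
      (t := (Finset.range N).filter (fun n => k < n ∧ f n = f k) ∪
        (Finset.range N).filter (fun n => n < k ∧ g n = g k)) ?_ fun n _ _ => h0 k n).trans ?_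
    · intro n hn
      simp only [Finset.mem_filter, Finset.mem_union, Prod.mk.injEq] at hn ⊢
      rcases lt_or_gt_of_ne hn.2.1 with h | h
      · exact Or.inr ⟨hn.1, h, hn.2.2.2⟩
      · exact Or.inl ⟨hn.1, h, hn.2.2.1⟩
    · rw [Finset.sum_union]
      · linarith
      · rw [Finset.disjoint_filter]
        intro n _ h h'
        exact lt_asymm h.1 h'.1
  choose f hf using hfin
  obtain ⟨c, hc⟩ := exists_limit_coloring f
  refine ⟨K, c, fun A hA k hk => ?_⟩
  rw [tsum_subtype (A \ {k}) (M k)]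
  refine Real.tsum_le_of_sum_range_le (fun n => Set.indicator_nonneg (fun n _ => h0 k n) n)
    fun L => ?_
  obtain ⟨N, hN, hNc⟩ := hc (max L (k + 1))
  have hLN : L ≤ N := (le_max_left _ _).trans hN
  have hkN : k < max L (k + 1) := lt_max_of_lt_right k.lt_succ_self
  refine le_trans ?_ (hf N k (hkN.trans_le hN))
  rw [Finset.sum_indicator_eq_sum_filter]
  refine Finset.sum_le_sum_of_subset_of_nonneg ?_ fun n _ _ => h0 k n
  intro n hn
  simp only [Finset.mem_filter, Finset.mem_range, Set.mem_sdiff, Set.mem_singleton_iff] at hn ⊢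
  refine ⟨hn.1.trans_le hLN, hn.2.2, ?_⟩
  rw [hNc n (lt_max_of_lt_left hn.1), hNc k hkN]
  exact hA n hn.2.1 k hk

/-- A family of sets of naturals that no single set splits. -/
def IsReaping (F : Set (Set ℕ)) : Prop :=
  ¬ ∃ X : Set ℕ, ∀ A ∈ F, (A ∩ X).Infinite ∧ (A \ X).Infinite

/-- A finite family of infinite sets can be split by one set. -/
lemma IsReaping.infinite {F : Set (Set ℕ)} (hF : IsReaping F) (hinf : ∀ A ∈ F, A.Infinite) :
    F.Infinite := by
  intro hfin
  have hex : ∀ n, ∃ m, n < m ∧ ∀ A ∈ F, ∃ a ∈ A, n ≤ a ∧ a < m := fun n => by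
    have h : ∀ A ∈ F, ∀ᶠ m in Filter.atTop, ∃ a ∈ A, n ≤ a ∧ a < m := fun A hA => by
      obtain ⟨a, ha, hna⟩ := (hinf A hA).exists_gt n
      filter_upwards [Filter.eventually_gt_atTop a] with m hm using ⟨a, ha, hna.le, hm⟩
    exact ((Filter.eventually_gt_atTop n).and
      ((Filter.eventually_all_finite hfin).2 h)).exists
  choose h hlt hh using hex
  let g : ℕ → ℕ := fun n => h^[n] 0
  have hg : ∀ n, g (n + 1) = h (g n) := fun n => Function.iterate_succ_apply' h n 0
  have hmono : StrictMono g := strictMono_nat_of_lt_succ fun n => (hg n).symm ▸ hlt (g n)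
  have hblock : ∀ A ∈ F, ∀ n, ∃ a ∈ A, g n ≤ a ∧ a < g (n + 1) := fun A hA n =>
    (hg n).symm ▸ hh (g n) A hA
  refine hF ⟨{k | ∃ n, g (2 * n) ≤ k ∧ k < g (2 * n + 1)}, fun A hA => ⟨?_, ?_⟩⟩
  · refine Set.infinite_of_forall_exists_gt fun b => ?_
    obtain ⟨a, ha, h1, h2⟩ := hblock A hA (2 * (b + 1))
    exact ⟨a, ⟨ha, b + 1, h1, h2⟩, by have := hmono.le_apply (x := 2 * (b + 1)); omega⟩
  · refine Set.infinite_of_forall_exists_gt fun b => ?_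
    obtain ⟨a, ha, h1, h2⟩ := hblock A hA (2 * b + 1)
    refine ⟨a, ⟨ha, ?_⟩, by have := hmono.le_apply (x := 2 * b + 1); omega⟩
    rintro ⟨n, h3, h4⟩
    have h5 := hmono.lt_iff_lt.1 (h1.trans_lt h4)
    have h6 := hmono.lt_iff_lt.1 (h3.trans_lt h2)
    omega

/-- The composition of the increasing enumerations of the sets in a list. -/
noncomputable def enumList : List (Set ℕ) → ℕ → ℕ
  | [] => id
  | A :: l => Nat.nth (· ∈ A) ∘ enumList l

lemma enumList_injective : ∀ l : List (Set ℕ), (∀ A ∈ l, A.Infinite) →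
    Function.Injective (enumList l)
  | [], _ => Function.injective_id
  | A :: l, h => (Nat.nth_injective (h A (by simp))).comp
      (enumList_injective l fun B hB => h B (by simp [hB]))

/-- A reaping family stabilizes every finite colouring after finitely many passages to
enumerations of its members. -/
lemma IsReaping.exists_eventually_const {F : Set (Set ℕ)} (hF : IsReaping F)
    (hinf : ∀ A ∈ F, A.Infinite) {ι : Type*} (s : Finset ι) :
    ∀ c : ℕ → ι, (∀ᶠ i in Filter.atTop, c i ∈ s) →
      ∃ (l : List F) (v : ι), ∀ᶠ i in Filter.atTop, c (enumList (l.map (↑)) i) = v := by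
  classical
  induction s using Finset.induction_on with
  | empty =>
    intro c hc
    simpa using hc.exists
  | insert v s _ ih =>
    intro c hc
    obtain ⟨A, hA, hsplit⟩ : ∃ A ∈ F, (A ∩ {i | c i = v}).Infinite →
        ¬ (A \ {i | c i = v}).Infinite := by
      by_contra! h
      exact hF ⟨{i | c i = v}, h⟩
    have hnth : Filter.Tendsto (Nat.nth (· ∈ A)) Filter.atTop Filter.atTop :=
      (Nat.nth_strictMono (hinf A hA)).tendsto_atTop
    have hmem : ∀ i, Nat.nth (· ∈ A) i ∈ A := Nat.nth_mem_of_infinite (hinf A hA)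
    have hout : ∀ {B : Set ℕ}, B.Finite → ∀ᶠ i in Filter.atTop, Nat.nth (· ∈ A) i ∉ B :=
      fun {B} hB => hnth.eventually
        ((Nat.cofinite_eq_atTop ▸ hB.compl_mem_cofinite : Bᶜ ∈ Filter.atTop))
    by_cases hfin : (A ∩ {i | c i = v}).Infinite
    · refine ⟨[⟨A, hA⟩], v, ?_⟩
      filter_upwards [hout (Set.not_infinite.1 (hsplit hfin))] with i hi
      by_contra hne
      exact hi ⟨hmem i, hne⟩
    · obtain ⟨l, w, hl⟩ := ih (c ∘ Nat.nth (· ∈ A)) (by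
        filter_upwards [hout (Set.not_infinite.1 hfin), hnth.eventually hc] with i hi hi'
        exact (Finset.mem_insert.1 hi').resolve_left fun h => hi ⟨hmem i, h⟩)
      exact ⟨⟨A, hA⟩ :: l, w, hl⟩

/-- The tails of the iterated enumerations along a family form a Rosenthal family if the family is
reaping. -/
lemma IsReaping.isRosenthalFamily {F : Set (Set ℕ)} (hF : IsReaping F)
    (hinf : ∀ A ∈ F, A.Infinite) :
    IsRosenthalFamily (Set.range fun p : List F × ℕ =>
      enumList (p.1.map (↑)) '' Set.Ici p.2) := by
  refine ⟨?_, fun M hM ε hε => ?_⟩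
  · rintro _ ⟨⟨l, n⟩, rfl⟩
    refine (Set.Ici_infinite n).image (enumList_injective _ fun A hA => ?_).injOn
    obtain ⟨B, -, rfl⟩ := List.mem_map.1 hA
    exact hinf B B.2
  · obtain ⟨K, c, hc⟩ := hM.exists_paving hε
    obtain ⟨l, v, hl⟩ := hF.exists_eventually_const hinf Finset.univ c (by simp)
    obtain ⟨n, hn⟩ := Filter.eventually_atTop.1 hl
    refine ⟨_, ⟨(l, n), rfl⟩, hc _ ?_⟩
    rintro _ ⟨i, hi, rfl⟩ _ ⟨j, hj, rfl⟩
    rw [hn i hi, hn j hj]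

lemma isReaping_setOf_infinite : IsReaping {A | A.Infinite} := by
  rintro ⟨X, hX⟩
  by_cases h : X.Infinite
  · simpa using (hX X h).2
  · simpa using (hX Xᶜ (Set.not_infinite.1 h).infinite_compl).1

/-- The Rosenthal number `ros` is at most the reaping number `𝔯`. -/
theorem rosenthal_le_reaping : rosenthalNumber ≤ reapingNumber := by
  refine le_csInf ⟨_, {A | A.Infinite}, fun _ h => h, isReaping_setOf_infinite, rfl⟩ ?_
  rintro _ ⟨F, hinf, hF, rfl⟩
  have : Infinite F := (IsReaping.infinite hF hinf).to_subtype
  have hle := csInf_le' (s := {c | ∃ F : Set (Set ℕ), IsRosenthalFamily F ∧ Cardinal.mk F = c})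
    ⟨_, IsReaping.isRosenthalFamily hF hinf, rfl⟩
  refine hle.trans (Cardinal.mk_range_le.trans ?_)
  rw [Cardinal.mk_prod, Cardinal.lift_id, Cardinal.lift_id, Cardinal.mk_list_eq_mk, Cardinal.mk_nat,
    Cardinal.mul_aleph0_eq (Cardinal.aleph0_le_mk F)]
end

section
/- The minimum of the dominating number 𝔡 and the reaping number 𝔯 is less than or equal to the binary c₀-Rosenthal number ros_01(c₀). -/
/-- A *binary `c₀`-Rosenthal family*: a family of infinite subsets of `ℕ` such that for
every finite-to-one fixed-point-free `f : ℕ → ℕ` there is `A` in the family with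
`f[A] ∩ A = ∅`. -/
def IsBinaryC0RosenthalFamily (F : Set (Set ℕ)) : Prop :=
  (∀ A ∈ F, A.Infinite) ∧
    ∀ f : ℕ → ℕ, (∀ n, f n ≠ n) → (∀ n, (f ⁻¹' {n}).Finite) → ∃ A ∈ F, f '' A ∩ A = ∅

/-- The binary `c₀`-Rosenthal number `ros_01(c₀)`: the minimal cardinality of a binary
`c₀`-Rosenthal family. -/
noncomputable def binaryC0RosenthalNumber : Cardinal :=
  sInf {c | ∃ F : Set (Set ℕ), IsBinaryC0RosenthalFamily F ∧ Cardinal.mk F = c}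

/-- The dominating number `𝔡`: the minimal cardinality of a family `D ⊆ ℕ^ℕ` such that
every `f : ℕ → ℕ` is eventually dominated by a member of `D`. -/
noncomputable def dominatingNumber : Cardinal :=
  sInf {c | ∃ D : Set (ℕ → ℕ),
    (∀ f : ℕ → ℕ, ∃ g ∈ D, ∀ᶠ k in Filter.atTop, f k ≤ g k) ∧ Cardinal.mk D = c}

/-- A family of fewer than `𝔡` functions is not dominating. -/
theorem exists_not_dominated_of_mk_lt {ι : Type} (g : ι → ℕ → ℕ)
    (hι : Cardinal.mk ι < dominatingNumber) : ∃ h : ℕ → ℕ, ∀ i, ∃ k, g i k < h k := by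
  by_contra! hcon
  refine (Cardinal.mk_range_le.trans_lt hι).not_ge (csInf_le' ⟨Set.range g, fun f => ?_, rfl⟩)
  obtain ⟨i, hi⟩ := hcon f
  exact ⟨g i, ⟨i, rfl⟩, Filter.Eventually.of_forall hi⟩

/-- A family of fewer than `𝔯` infinite sets is split by a single set. -/
theorem exists_splitting_of_mk_lt {ι : Type} (B : ι → Set ℕ) (hB : ∀ i, (B i).Infinite)
    (hι : Cardinal.mk ι < reapingNumber) :
    ∃ X : Set ℕ, ∀ i, (B i ∩ X).Infinite ∧ (B i \ X).Infinite := by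
  by_contra hcon
  refine (Cardinal.mk_range_le.trans_lt hι).not_ge
    (csInf_le' ⟨Set.range B, Set.forall_mem_range.2 hB, ?_, rfl⟩)
  rintro ⟨X, hX⟩
  exact hcon ⟨X, fun i => hX _ ⟨i, rfl⟩⟩

/-- For fewer than `𝔯` infinite sets there is a colouring with countably many colours in which
every colour appears infinitely often on each of the sets. -/
theorem exists_coloring_of_mk_lt {ι : Type} (B : ι → Set ℕ) (hB : ∀ i, (B i).Infinite)
    (hι : Cardinal.mk ι < reapingNumber) :
    ∃ c : ℕ → ℕ, ∀ i j, (B i ∩ c ⁻¹' {j}).Infinite := by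
  have step : ∀ U : {U : Set ℕ // ∀ i, (B i \ U).Infinite},
      ∃ V : {U : Set ℕ // ∀ i, (B i \ U).Infinite},
        U.1 ⊆ V.1 ∧ ∀ i, (B i ∩ (V.1 \ U.1)).Infinite := by
    rintro ⟨U, hU⟩
    obtain ⟨X, hX⟩ := exists_splitting_of_mk_lt (fun i => B i \ U) hU hι
    refine ⟨⟨U ∪ X, fun i => ?_⟩, Set.subset_union_left, fun i => ?_⟩
    · rw [← Set.sdiff_sdiff]
      exact (hX i).2
    · refine (hX i).1.mono ?_
      rintro a ⟨⟨haB, haU⟩, haX⟩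
      exact ⟨haB, Or.inr haX, haU⟩
  choose next hsub hinf using step
  let U : ℕ → {U : Set ℕ // ∀ i, (B i \ U).Infinite} :=
    fun n => Nat.rec ⟨∅, by simpa using hB⟩ (fun _ V => next V) n
  have hmono : Monotone fun n => (U n).1 := monotone_nat_of_le_succ fun n => hsub (U n)
  refine ⟨fun a => sInf {j | a ∈ (U (j + 1)).1}, fun i j => (hinf (U j) i).mono ?_⟩
  rintro a ⟨haB, haV, haU⟩
  refine ⟨haB, le_antisymm (Nat.sInf_le haV) (le_csInf ⟨j, haV⟩ fun l hl => ?_)⟩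
  by_contra! hlj
  exact haU (hmono (Nat.succ_le_of_lt hlj) hl)

/-- The infinite subsets of `ℕ` form a binary `c₀`-Rosenthal family. -/
theorem isBinaryC0RosenthalFamily_infinite : IsBinaryC0RosenthalFamily {A | A.Infinite} := by
  refine ⟨fun _ hA => hA, fun f hf hfin => ?_⟩
  obtain ⟨a, -, ha⟩ := exists_seq_of_forall_finset_exists (fun _ : ℕ => True)
    (fun x y => x ≠ y ∧ f x ≠ y ∧ f y ≠ x) (fun s _ => by
      have hs : ((s : Set ℕ) ∪ f '' s ∪ ⋃ x ∈ s, f ⁻¹' {x}).Finite :=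
        (s.finite_toSet.union (s.finite_toSet.image f)).union
          (s.finite_toSet.biUnion fun x _ => hfin x)
      obtain ⟨y, hy⟩ := hs.exists_notMem
      refine ⟨y, trivial, fun x hx => ⟨?_, ?_, ?_⟩⟩
      · rintro rfl
        exact hy (Or.inl (Or.inl hx))
      · rintro rfl
        exact hy (Or.inl (Or.inr ⟨x, hx, rfl⟩))
      · rintro rfl
        exact hy (Or.inr (Set.mem_biUnion hx rfl)))
  have hinj : Function.Injective a := by
    intro m n hmn
    rcases lt_trichotomy m n with h | h | h
    · exact absurd hmn (ha m n h).1
    · exact h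
    · exact absurd hmn.symm (ha n m h).1
  refine ⟨Set.range a, Set.infinite_range_of_injective hinj, ?_⟩
  rw [Set.eq_empty_iff_forall_notMem]
  rintro _ ⟨⟨_, ⟨m, rfl⟩, rfl⟩, ⟨n, hn⟩⟩
  rcases lt_trichotomy m n with h | rfl | h
  · exact (ha m n h).2.1 hn.symm
  · exact hf _ hn.symm
  · exact (ha n m h).2.2 hn.symm

/-- A binary `c₀`-Rosenthal family has at least `min(𝔡, 𝔯)` members. -/
theorem IsBinaryC0RosenthalFamily.min_le_mk {F : Set (Set ℕ)}
    (hF : IsBinaryC0RosenthalFamily F) :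
    min dominatingNumber reapingNumber ≤ Cardinal.mk F := by
  by_contra! hlt
  obtain ⟨hd, hr⟩ := lt_min_iff.1 hlt
  obtain ⟨c, hc⟩ := exists_coloring_of_mk_lt (fun A : F => A.1) (fun A => hF.1 A A.2) hr
  have hpair : ∀ (A : F) (k : ℕ), ∃ q ∈ A.1, c q ∈ A.1 ∧ k ≤ c q ∧ c q < q := by
    intro A k
    obtain ⟨p, hpA, hkp⟩ := (hF.1 A A.2).exists_gt k
    obtain ⟨q, ⟨hqA, rfl⟩, hpq⟩ := (hc A p).exists_gt p
    exact ⟨q, hqA, hpA, hkp.le, hpq⟩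
  choose g hgA hcA hkc hcg using hpair
  obtain ⟨h, hh⟩ := exists_not_dominated_of_mk_lt g hd
  classical
  let f : ℕ → ℕ := fun q => if c q < q ∧ ∃ k ≤ c q, q < h k then c q else q + 1
  have hfix : ∀ n, f n ≠ n := by
    intro n
    dsimp only [f]
    split_ifs with hn
    · exact hn.1.ne
    · exact n.succ_ne_self
  have hfin : ∀ n, (f ⁻¹' {n}).Finite := by
    intro n
    refine (((Set.finite_Iic n).biUnion fun k _ => Set.finite_Iio (h k)).union
      (Set.finite_Iio n)).subset fun q hq => ?_
    change f q = n at hq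
    dsimp only [f] at hq
    split_ifs at hq with hq'
    · obtain ⟨-, k, hk, hqk⟩ := hq'
      exact Or.inl (Set.mem_biUnion (hq ▸ hk : k ≤ n) hqk)
    · exact Or.inr (hq ▸ q.lt_succ_self)
  obtain ⟨A, hA, hfA⟩ := hF.2 f hfix hfin
  obtain ⟨k, hk⟩ := hh ⟨A, hA⟩
  exact Set.eq_empty_iff_forall_notMem.1 hfA (c (g ⟨A, hA⟩ k))
    ⟨⟨g ⟨A, hA⟩ k, hgA ⟨A, hA⟩ k, if_pos ⟨hcg _ _, k, hkc _ _, hk⟩⟩, hcA ⟨A, hA⟩ k⟩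

/-- `min(𝔡, 𝔯)` is at most the binary `c₀`-Rosenthal number `ros_01(c₀)`. -/
theorem min_dominating_reaping_le_binaryC0Rosenthal :
    min dominatingNumber reapingNumber ≤ binaryC0RosenthalNumber := by
  refine le_csInf ⟨_, _, isBinaryC0RosenthalFamily_infinite, rfl⟩ ?_
  rintro _ ⟨F, hF, rfl⟩
  exact hF.min_le_mk
end

section
/- The binary c₀-Rosenthal number ros_01(c₀) is equal to the minimum of the dominating number 𝔡 and the reaping number 𝔯. -/
open Cardinal Filter

/-- A `Bool`-colouring alternating along the descending edges `f n < n`. -/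
def descColor (f : ℕ → ℕ) (n : ℕ) : Bool :=
  if _h : f n < n then !descColor f (f n) else false
termination_by n

/-- A `Bool`-colouring alternating along the ascending edges `n < f n` with `n < N`. -/
def ascColor (f : ℕ → ℕ) (N n : ℕ) : Bool :=
  if _h : n < f n ∧ n < N then !ascColor f N (f n) else false
termination_by N - n

lemma descColor_apply {f : ℕ → ℕ} {n : ℕ} (h : f n < n) :
    descColor f n = !descColor f (f n) := by
  rw [descColor, dif_pos h]

lemma ascColor_apply {f : ℕ → ℕ} {N n : ℕ} (h : n < f n) (hN : n < N) :
    ascColor f N n = !ascColor f N (f n) := by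
  rw [ascColor, dif_pos ⟨h, hN⟩]

/-- A set that alternates along all ascending edges of `f`, obtained as an ultrafilter limit. -/
lemma exists_alternating_asc (f : ℕ → ℕ) :
    ∃ C : Set ℕ, ∀ n, n < f n → (n ∈ C ↔ f n ∉ C) := by
  refine ⟨{n | ∀ᶠ N in (hyperfilter ℕ : Filter ℕ), ascColor f N n = true}, fun n hn => ?_⟩
  have hlt : ∀ᶠ N in (hyperfilter ℕ : Filter ℕ), n < N :=
    (Nat.hyperfilter_le_atTop) (eventually_gt_atTop n)
  simp only [Set.mem_ofPred_eq]
  rw [← Ultrafilter.eventually_not]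
  refine eventually_congr (hlt.mono fun N hN => ?_)
  rw [ascColor_apply hn hN]
  simp

/-- A set that alternates along all descending edges of `f`. -/
lemma exists_alternating_desc (f : ℕ → ℕ) :
    ∃ C : Set ℕ, ∀ n, f n < n → (n ∈ C ↔ f n ∉ C) :=
  ⟨{n | descColor f n = true}, fun n hn => by simp [descColor_apply hn]⟩

/-- A countable family of infinite subsets of `ℕ` is split by a single set. -/
lemma exists_splitting_of_countable {F : Set (Set ℕ)} (hF : ∀ A ∈ F, A.Infinite)
    (hc : F.Countable) : ∃ X : Set ℕ, ∀ A ∈ F, (A ∩ X).Infinite ∧ (A \ X).Infinite := by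
  rcases F.eq_empty_or_nonempty with rfl | hne
  · exact ⟨∅, by simp⟩
  obtain ⟨s, rfl⟩ := hc.exists_eq_range hne
  have hnext : ∀ i n, ∃ m ∈ s i, n < m := fun i n => (hF _ ⟨i, rfl⟩).exists_gt n
  choose next hmem hgt using hnext
  let x : ℕ → ℕ := fun k => Nat.rec (next (Nat.unpair 0).1 0)
    (fun k r => next (Nat.unpair (k + 1)).1 r) k
  have hx : StrictMono x := strictMono_nat_of_lt_succ fun k => hgt _ _
  have hxs : ∀ k, x k ∈ s (Nat.unpair k).1 := by
    rintro (_ | k) <;> exact hmem _ _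
  refine ⟨x '' {k | Even (Nat.unpair k).2}, ?_⟩
  rintro _ ⟨i, rfl⟩
  have hinj : ∀ t : ℕ → ℕ, t.Injective → (fun j => x (Nat.pair i (t j))).Injective := by
    intro t ht a b hab
    have := hx.injective hab
    rw [Nat.pair_eq_pair] at this
    exact ht this.2
  have hin : ∀ j, x (Nat.pair i j) ∈ s i := fun j => by simpa using hxs (Nat.pair i j)
  constructor
  · refine (Set.infinite_range_of_injective (hinj (fun j => 2 * j) fun a b h => by
      simpa using h)).mono ?_
    rintro _ ⟨j, rfl⟩
    exact ⟨hin _, _, by simp, rfl⟩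
  · refine (Set.infinite_range_of_injective (hinj (fun j => 2 * j + 1) fun a b h => by
      simpa using h)).mono ?_
    rintro _ ⟨j, rfl⟩
    refine ⟨hin _, ?_⟩
    rintro ⟨k, hk, hkx⟩
    rw [hx.injective hkx] at hk
    simp at hk

lemma not_eventually_dominates_of_finite {D : Set (ℕ → ℕ)} (hD : D.Finite) :
    ∃ f : ℕ → ℕ, ∀ g ∈ D, ¬ ∀ᶠ k in atTop, f k ≤ g k := by
  refine ⟨fun k => ∑ g ∈ hD.toFinset, g k + 1, fun g hg h => ?_⟩
  obtain ⟨k, hk⟩ := h.exists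
  have : g k ≤ ∑ g ∈ hD.toFinset, g k :=
    Finset.single_le_sum (f := fun g : ℕ → ℕ => g k) (fun _ _ => Nat.zero_le _)
      (hD.mem_toFinset.2 hg)
  lia

lemma exists_dominating_family : ∃ D : Set (ℕ → ℕ), ℵ₀ ≤ #D ∧ #D = dominatingNumber ∧
    ∀ f : ℕ → ℕ, ∃ g ∈ D, ∀ᶠ k in atTop, f k ≤ g k := by
  obtain ⟨D, hD, hcard⟩ := csInf_mem (s := {c | ∃ D : Set (ℕ → ℕ),
    (∀ f : ℕ → ℕ, ∃ g ∈ D, ∀ᶠ k in atTop, f k ≤ g k) ∧ #D = c})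
    ⟨_, Set.univ, fun f => ⟨f, trivial, .of_forall fun _ => le_rfl⟩, rfl⟩
  refine ⟨D, ?_, hcard, hD⟩
  by_contra! h
  obtain ⟨f, hf⟩ := not_eventually_dominates_of_finite (lt_aleph0_iff_set_finite.1 h)
  obtain ⟨g, hg, hfg⟩ := hD f
  exact hf g hg hfg

lemma exists_reaping_family : ∃ R : Set (Set ℕ), ℵ₀ ≤ #R ∧ #R = reapingNumber ∧
    (∀ A ∈ R, A.Infinite) ∧ ∀ X : Set ℕ, ∃ A ∈ R, (A ∩ X).Finite ∨ (A \ X).Finite := by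
  obtain ⟨R, hinf, hR, hcard⟩ := csInf_mem (s := {c | ∃ F : Set (Set ℕ), (∀ A ∈ F, A.Infinite) ∧
    (¬ ∃ X : Set ℕ, ∀ A ∈ F, (A ∩ X).Infinite ∧ (A \ X).Infinite) ∧ #F = c}) (by
      refine ⟨_, {A | A.Infinite}, fun A hA => hA, ?_, rfl⟩
      rintro ⟨X, hX⟩
      have hfin : ¬ X.Infinite := fun h => by simpa using (hX X h).2
      exact hfin ((hX _ Set.infinite_univ).1.mono Set.inter_subset_right))
  refine ⟨R, ?_, hcard, hinf, ?_⟩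
  · by_contra! h
    exact hR (exists_splitting_of_countable hinf (lt_aleph0_iff_set_finite.1 h).countable)
  · by_contra! h
    exact hR h

lemma binaryC0RosenthalNumber_le {F : Set (Set ℕ)} (hF : IsBinaryC0RosenthalFamily F) :
    binaryC0RosenthalNumber ≤ #F :=
  csInf_le' ⟨F, hF, rfl⟩

/-- The sequence obtained by iterating `a ↦ max a (g a) + 1` from `N`. -/
def sparseSeq (g : ℕ → ℕ) (N k : ℕ) : ℕ := (fun a => max a (g a) + 1)^[k] N

lemma sparseSeq_succ (g : ℕ → ℕ) (N k : ℕ) :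
    sparseSeq g N (k + 1) = max (sparseSeq g N k) (g (sparseSeq g N k)) + 1 :=
  Function.iterate_succ_apply' _ _ _

lemma sparseSeq_strictMono (g : ℕ → ℕ) (N : ℕ) : StrictMono (sparseSeq g N) :=
  strictMono_nat_of_lt_succ fun k => by rw [sparseSeq_succ]; lia

lemma exists_bound_image_preimage {f : ℕ → ℕ} (hf : ∀ n, (f ⁻¹' {n}).Finite) (n : ℕ) :
    ∃ b, f n ≤ b ∧ ∀ m, f m ≤ n → m ≤ b := by
  have hfin : (f ⁻¹' Set.Iic n).Finite :=
    (Set.finite_Iic n).preimage' fun m _ => hf m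
  obtain ⟨b, hb⟩ := hfin.bddAbove
  exact ⟨max (f n) b, le_max_left _ _, fun m hm => (hb hm).trans (le_max_right _ _)⟩

lemma isBinaryC0RosenthalFamily_sparseSeq {D : Set (ℕ → ℕ)}
    (hD : ∀ f : ℕ → ℕ, ∃ g ∈ D, ∀ᶠ k in atTop, f k ≤ g k) :
    IsBinaryC0RosenthalFamily
      (Set.range fun p : D × ℕ => Set.range (sparseSeq (p.1 : ℕ → ℕ) p.2)) := by
  refine ⟨?_, fun f hfix hfin => ?_⟩
  · rintro _ ⟨p, rfl⟩
    exact Set.infinite_range_of_injective (sparseSeq_strictMono _ _).injective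
  choose b hb hb' using exists_bound_image_preimage hfin
  obtain ⟨g, hg, hbg⟩ := hD b
  obtain ⟨N, hN⟩ := eventually_atTop.1 hbg
  refine ⟨_, ⟨(⟨g, hg⟩, N), rfl⟩, ?_⟩
  have hmono := sparseSeq_strictMono g N
  have hlt : ∀ i j, i < j → b (sparseSeq g N i) < sparseSeq g N j := by
    intro i j hij
    have h1 := hN (sparseSeq g N i) (hmono.monotone (Nat.zero_le i))
    have h2 := hmono.monotone (Nat.succ_le_of_lt hij)
    rw [Nat.succ_eq_add_one, sparseSeq_succ] at h2
    lia
  rw [Set.eq_empty_iff_forall_notMem]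
  rintro _ ⟨⟨_, ⟨i, rfl⟩, rfl⟩, j, hj⟩
  change sparseSeq g N j = f (sparseSeq g N i) at hj
  rcases lt_trichotomy i j with h | rfl | h
  · exact (hlt i j h).not_ge (hj ▸ hb _)
  · exact hfix _ hj.symm
  · exact (hlt j i h).not_ge (hb' _ _ hj.ge)

lemma binaryC0RosenthalNumber_le_dominatingNumber :
    binaryC0RosenthalNumber ≤ dominatingNumber := by
  obtain ⟨D, hinf, hcard, hD⟩ := exists_dominating_family
  calc binaryC0RosenthalNumber
      ≤ _ := binaryC0RosenthalNumber_le (isBinaryC0RosenthalFamily_sparseSeq hD)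
    _ ≤ #(D × ℕ) := mk_range_le
    _ = dominatingNumber := by
      rw [mk_prod, lift_id, lift_id, mk_nat, mul_eq_left hinf hinf aleph0_ne_zero, hcard]

/-- The tail of the copy of `B` inside `A` given by the increasing enumeration of `A`. -/
noncomputable def reindexTail (A B : Set ℕ) (N : ℕ) : Set ℕ :=
  (Nat.nth (· ∈ A) '' B) \ Set.Iio N

lemma exists_tail_subset_or_disjoint {S X : Set ℕ} (h : (S ∩ X).Finite ∨ (S \ X).Finite) :
    ∃ N, (∀ n ∈ S, N ≤ n → n ∉ X) ∨ ∀ n ∈ S, N ≤ n → n ∈ X := by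
  rcases h with h | h
  · obtain ⟨b, hb⟩ := h.bddAbove
    exact ⟨b + 1, .inl fun n hn hN hX => absurd (hb ⟨hn, hX⟩) (by lia)⟩
  · obtain ⟨b, hb⟩ := h.bddAbove
    exact ⟨b + 1, .inr fun n hn hN => by_contra fun hX => absurd (hb ⟨hn, hX⟩) (by lia)⟩

lemma isBinaryC0RosenthalFamily_reindexTail {R : Set (Set ℕ)} (hinf : ∀ A ∈ R, A.Infinite)
    (hR : ∀ X : Set ℕ, ∃ A ∈ R, (A ∩ X).Finite ∨ (A \ X).Finite) :
    IsBinaryC0RosenthalFamily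
      (Set.range fun p : (R × R) × ℕ => reindexTail p.1.1 p.1.2 p.2) := by
  refine ⟨?_, fun f hfix _ => ?_⟩
  · rintro _ ⟨⟨⟨A, B⟩, N⟩, rfl⟩
    exact ((hinf _ B.2).image (Nat.nth_injective (hinf _ A.2)).injOn).sdiff (Set.finite_Iio N)
  obtain ⟨C, hC⟩ := exists_alternating_asc f
  obtain ⟨C', hC'⟩ := exists_alternating_desc f
  obtain ⟨A, hA, hAX⟩ := hR {n | n < f n}
  obtain ⟨N, hN⟩ := exists_tail_subset_or_disjoint hAX
  have hiter : ∀ Y : Set ℕ, ∃ B ∈ R, ∃ M, (∀ n ∈ reindexTail A B M, n ∉ Y) ∨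
      ∀ n ∈ reindexTail A B M, n ∈ Y := by
    intro Y
    obtain ⟨B, hB, hBY⟩ := hR (Nat.nth (· ∈ A) ⁻¹' Y)
    have : ((Nat.nth (· ∈ A) '' B) ∩ Y).Finite ∨ ((Nat.nth (· ∈ A) '' B) \ Y).Finite := by
      refine hBY.imp (fun h => ?_) fun h => ?_
      · rw [← Set.image_inter_preimage]; exact h.image _
      · rw [← Set.image_sdiff_preimage]; exact h.image _
    obtain ⟨M, hM⟩ := exists_tail_subset_or_disjoint this
    exact ⟨B, hB, M, hM.imp (fun h n hn => h n hn.1 (not_lt.1 hn.2))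
      fun h n hn => h n hn.1 (not_lt.1 hn.2)⟩
  obtain ⟨Y, hY⟩ : ∃ Y : Set ℕ, ∀ n ∈ A, N ≤ n → (n ∈ Y ↔ f n ∉ Y) := by
    rcases hN with hN | hN
    · exact ⟨C', fun n hn h => hC' n (lt_of_le_of_ne (not_lt.1 (hN n hn h)) (hfix n))⟩
    · exact ⟨C, fun n hn h => hC n (hN n hn h)⟩
  obtain ⟨B, hB, M, hM⟩ := hiter Y
  refine ⟨_, ⟨((⟨A, hA⟩, ⟨B, hB⟩), max N M), rfl⟩, ?_⟩
  have hsub : ∀ n ∈ reindexTail A B (max N M), n ∈ A ∧ N ≤ n ∧ n ∈ reindexTail A B M := by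
    rintro _ ⟨⟨k, hk, rfl⟩, hn⟩
    rw [Set.mem_Iio, not_lt, max_le_iff] at hn
    exact ⟨Nat.nth_mem_of_infinite (hinf A hA) k, hn.1, ⟨k, hk, rfl⟩, not_lt.2 hn.2⟩
  rw [Set.eq_empty_iff_forall_notMem]
  rintro _ ⟨⟨n, hn, rfl⟩, hfn⟩
  obtain ⟨hnA, hnN, hnM⟩ := hsub n hn
  have hiff := hY n hnA hnN
  rcases hM with hM | hM
  · exact hM n hnM (hiff.2 (hM _ (hsub _ hfn).2.2))
  · exact hiff.1 (hM n hnM) (hM _ (hsub _ hfn).2.2)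

lemma binaryC0RosenthalNumber_le_reapingNumber :
    binaryC0RosenthalNumber ≤ reapingNumber := by
  obtain ⟨R, hinf, hcard, hR, hreap⟩ := exists_reaping_family
  calc binaryC0RosenthalNumber
      ≤ _ := binaryC0RosenthalNumber_le (isBinaryC0RosenthalFamily_reindexTail hR hreap)
    _ ≤ #((R × R) × ℕ) := mk_range_le
    _ = reapingNumber := by
      rw [hcard] at hinf
      simp only [mk_prod, lift_id, mk_nat, hcard, mul_eq_self hinf,
        mul_eq_left hinf hinf aleph0_ne_zero]

lemma exists_splitting_of_lt_reapingNumber {F : Set (Set ℕ)} (hF : ∀ A ∈ F, A.Infinite)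
    (hlt : #F < reapingNumber) :
    ∃ X : Set ℕ, ∀ A ∈ F, (A ∩ X).Infinite ∧ (A \ X).Infinite := by
  by_contra h
  exact notMem_of_lt_csInf' hlt ⟨F, hF, h, rfl⟩

lemma exists_not_dominated_of_lt_dominatingNumber {D : Set (ℕ → ℕ)}
    (hlt : #D < dominatingNumber) :
    ∃ h : ℕ → ℕ, Monotone h ∧ ∀ g ∈ D, ∃ k, g k < h k := by
  obtain ⟨f, hf⟩ : ∃ f : ℕ → ℕ, ∀ g ∈ D, ¬ ∀ᶠ k in atTop, f k ≤ g k := by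
    by_contra! h
    exact notMem_of_lt_csInf' hlt ⟨D, h, rfl⟩
  refine ⟨partialSups f, (partialSups f).monotone, fun g hg => ?_⟩
  obtain ⟨k, hk⟩ := (not_eventually.1 (hf g hg)).exists
  exact ⟨k, (not_le.1 hk).trans_le (le_partialSups f k)⟩

/-- A family smaller than `𝔯` admits a colouring of `ℕ` by countably many colours in which every
member of the family meets every colour infinitely often. -/
lemma exists_coloring_of_lt_reapingNumber {F : Set (Set ℕ)} (hF : ∀ A ∈ F, A.Infinite)
    (hlt : #F < reapingNumber) :
    ∃ c : ℕ → ℕ, ∀ A ∈ F, ∀ i, (A ∩ c ⁻¹' {i}).Infinite := by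
  have hstep : ∀ P : Set ℕ, (∀ A ∈ F, (A \ P).Infinite) →
      ∃ X : Set ℕ, ∀ A ∈ F, ((A \ P) ∩ X).Infinite ∧ ((A \ P) \ X).Infinite := by
    intro P hP
    obtain ⟨X, hX⟩ := exists_splitting_of_lt_reapingNumber (F := (· \ P) '' F)
      (by rintro _ ⟨A, hA, rfl⟩; exact hP A hA) (mk_image_le.trans_lt hlt)
    exact ⟨X, fun A hA => hX _ ⟨A, hA, rfl⟩⟩
  choose X hX using hstep
  let Q : ℕ → {P : Set ℕ // ∀ A ∈ F, (A \ P).Infinite} := fun i => Nat.rec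
    ⟨∅, by simpa using hF⟩
    (fun _ P => ⟨P.1 ∪ X P.1 P.2, fun A hA => by
      rw [← Set.sdiff_sdiff]; exact (hX P.1 P.2 A hA).2⟩) i
  have hQ : ∀ i, (Q (i + 1)).1 = (Q i).1 ∪ X (Q i).1 (Q i).2 := fun _ => rfl
  have hmono : Monotone fun i => (Q i).1 :=
    monotone_nat_of_le_succ fun i => by
      rw [hQ]; exact Set.subset_union_left
  refine ⟨fun n => sInf {i | n ∈ (Q (i + 1)).1}, fun A hA i => ?_⟩
  refine (hX (Q i).1 (Q i).2 A hA).1.mono ?_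
  rintro n ⟨⟨hnA, hnQ⟩, hnX⟩
  have hn : i ∈ {i | n ∈ (Q (i + 1)).1} := by
    rw [Set.mem_ofPred_eq, hQ]; exact Or.inr hnX
  refine ⟨hnA, le_antisymm (Nat.sInf_le hn) (not_lt.1 fun hlt => ?_)⟩
  exact hnQ (hmono (Nat.succ_le_of_lt hlt) (Nat.sInf_mem ⟨i, hn⟩))

lemma not_isBinaryC0RosenthalFamily_of_lt {F : Set (Set ℕ)} (hd : #F < dominatingNumber)
    (hr : #F < reapingNumber) : ¬ IsBinaryC0RosenthalFamily F := by
  rintro ⟨hF, hros⟩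
  obtain ⟨c, hc⟩ := exists_coloring_of_lt_reapingNumber hF hr
  have hnext : ∀ (A : F) (n : ℕ), ∃ x ∈ A.1, ∃ y ∈ A.1, n < y ∧ y < x ∧ c x = y := by
    rintro ⟨A, hA⟩ n
    obtain ⟨y, hy, hny⟩ := (hF A hA).exists_gt n
    obtain ⟨x, ⟨hx, hxy⟩, hlt⟩ := (hc A hA y).exists_gt y
    exact ⟨x, hx, y, hy, hny, hlt, hxy⟩
  choose g hgA y hyA hny hyx hcy using hnext
  obtain ⟨h, hmono, hh⟩ := exists_not_dominated_of_lt_dominatingNumber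
    (D := Set.range g) (mk_range_le.trans_lt hd)
  let f : ℕ → ℕ := fun x => if c x < x ∧ x ≤ h (c x) then c x else x + 1
  obtain ⟨A, hA, hfA⟩ := hros f
    (fun n => by simp only [f]; split_ifs <;> lia)
    (fun n => (Set.finite_Iic (max n (h n))).subset fun x hx => by
      simp only [f, Set.mem_preimage, Set.mem_singleton_iff] at hx
      rw [Set.mem_Iic]
      split_ifs at hx with hcx
      · exact le_max_of_le_right (hx ▸ hcx.2)
      · exact le_max_of_le_left (by lia))
  obtain ⟨k, hk⟩ := hh _ ⟨⟨A, hA⟩, rfl⟩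
  have hfx : f (g ⟨A, hA⟩ k) = y ⟨A, hA⟩ k := by
    have := hmono (hny ⟨A, hA⟩ k).le
    simp only [f]
    rw [hcy, if_pos ⟨hyx _ _, hk.le.trans this⟩]
  exact hfA.subset ⟨⟨_, hgA ⟨A, hA⟩ k, hfx⟩, hyA ⟨A, hA⟩ k⟩

/-- The binary `c₀`-Rosenthal number `ros_01(c₀)` equals `min(𝔡, 𝔯)`. -/
theorem binaryC0Rosenthal_eq_min_dominating_reaping :
    binaryC0RosenthalNumber = min dominatingNumber reapingNumber := by
  refine le_antisymm (le_min binaryC0RosenthalNumber_le_dominatingNumber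
    binaryC0RosenthalNumber_le_reapingNumber) ?_
  obtain ⟨D, -, -, hD⟩ := exists_dominating_family
  obtain ⟨F, hF, hcard⟩ := csInf_mem (s := {c | ∃ F : Set (Set ℕ),
    IsBinaryC0RosenthalFamily F ∧ #F = c}) ⟨_, _, isBinaryC0RosenthalFamily_sparseSeq hD, rfl⟩
  by_contra! hlt
  obtain ⟨hd, hr⟩ := lt_min_iff.1 hlt
  exact not_isBinaryC0RosenthalFamily_of_lt (hcard.trans_lt hd) (hcard.trans_lt hr) hF
end
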